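/- Let 0 < j < j_m and 0 < k < k_m(j). If α ≥ 1, β ∈ ℝ and χ_{jk}(α,β) ≠ 0, then M^{2j+2k−2} ≤ α ≤ 2·M^{2j+2k} and (4M³)^{−1}·M^{2(j−k/3)} ≤ 1+β² ≤ 4M³·M^{2(j−k/3)}. -/

import Mathlib

open MeasureTheory Filter Set

noncomputable section

/-- The temperature scale `j_m = 1 + ⌊log(1/T)/log M⌋`. -/
def jmax (M T : ℝ) : ℕ := 1 + ⌊Real.log (1 / T) / Real.log M⌋₊

/-- The maximal auxiliary scale `k_m(j) = min(j_m − j, 3j)`. -/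
def kmax (M T : ℝ) (j : ℕ) : ℕ := min (jmax M T - j) (3 * j)

/-- `X_{αβ} = (1+β²)^{3/4}·(α+β²)^{1/4}`. -/
def Xab (α β : ℝ) : ℝ := (1 + β ^ 2) ^ ((3:ℝ)/4) * (α + β ^ 2) ^ ((1:ℝ)/4)

/-- The main slice cutoff `χ_j`: `χ_0(X) = u(X)`;
`χ_j(X) = u(X/M^{2j}) − u(X/M^{2j−2})` for `0 < j < j_m`;
`χ_{j_m}(X) = 1 − u(X/M^{2j_m−2})`. -/
def chiMain (u : ℝ → ℝ) (M : ℝ) (jm j : ℕ) (X : ℝ) : ℝ :=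
  if j = 0 then u X
  else if j = jm then 1 - u (X / M ^ (2 * jm - 2))
  else u (X / M ^ (2 * j)) - u (X / M ^ (2 * j - 2))

/-- The auxiliary slice cutoff `χ̃_k` (at main scale `j`): if `k_m(j) = 0` then `χ̃_0 ≡ 1`;
otherwise `χ̃_0(α) = u(α/M^{2j})`, `χ̃_k(α) = u(α/M^{2j+2k}) − u(α/M^{2j+2k−2})` for
`0 < k < k_m(j)` and `χ̃_{k_m(j)}(α) = 1 − u(α/M^{2j+2k_m(j)})`. -/
def chiAux (u : ℝ → ℝ) (M T : ℝ) (j k : ℕ) (α : ℝ) : ℝ :=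
  if kmax M T j = 0 then 1
  else if k = 0 then u (α / M ^ (2 * j))
  else if k = kmax M T j then 1 - u (α / M ^ (2 * j + 2 * kmax M T j))
  else u (α / M ^ (2 * j + 2 * k)) - u (α / M ^ (2 * j + 2 * k - 2))

/-- `χ_{jk}(α,β) = χ_j(X_{αβ})·χ̃_k(α)`. -/
def chiJK (u : ℝ → ℝ) (M T : ℝ) (j k : ℕ) (α β : ℝ) : ℝ :=
  chiMain u M (jmax M T) j (Xab α β) * chiAux u M T j k α

/-- A point where the difference `u (x / p) - u (x / q)` of two cutoffs does not vanish lies between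
`q` and `2 * p`. -/
lemma bounds_of_cutoff_sub_ne_zero {u : ℝ → ℝ} (hu1 : ∀ x : ℝ, x ≤ 1 → u x = 1)
    (hu2 : ∀ x : ℝ, 2 ≤ x → u x = 0) {x p q : ℝ} (hq : 0 < q) (hqp : q ≤ p)
    (h : u (x / p) - u (x / q) ≠ 0) : q ≤ x ∧ x ≤ 2 * p := by
  have hp : 0 < p := hq.trans_le hqp
  constructor
  · by_contra! hx
    exact h (by rw [hu1 _ ((div_le_one hp).2 (hx.le.trans hqp)), hu1 _ ((div_le_one hq).2 hx.le),
      sub_self])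
  · by_contra! hx
    have hqx : 2 * q ≤ x := by linarith
    exact h (by rw [hu2 _ ((le_div_iff₀ hp).2 hx.le), hu2 _ ((le_div_iff₀ hq).2 hqx), sub_self])

lemma Xab_nonneg {α : ℝ} (hα : 0 ≤ α) (β : ℝ) : 0 ≤ Xab α β := by
  unfold Xab
  positivity

lemma Xab_pow_four {α : ℝ} (hα : 0 ≤ α) (β : ℝ) :
    Xab α β ^ 4 = (1 + β ^ 2) ^ 3 * (α + β ^ 2) := by
  have h1 : (0 : ℝ) ≤ 1 + β ^ 2 := by positivity
  have h2 : (0 : ℝ) ≤ α + β ^ 2 := by positivity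
  rw [Xab, mul_pow, ← Real.rpow_mul_natCast h1, ← Real.rpow_mul_natCast h2]
  norm_num

/-- let `0 < j < j_m` and `0 < k < k_m(j)`. If `α ≥ 1`, `β ∈ ℝ` and
`χ_{jk}(α,β) ≠ 0`, then `M^{2j+2k−2} ≤ α ≤ 2·M^{2j+2k}` and
`(4M³)^{−1}·M^{2(j−k/3)} ≤ 1+β² ≤ 4M³·M^{2(j−k/3)}`. -/
theorem slicing_support_generic_case (M T : ℝ) (hM : 2 ≤ M) (hT0 : 0 < T) (hT1 : T ≤ 1)
    (u : ℝ → ℝ) (hu01 : ∀ x, 0 ≤ u x ∧ u x ≤ 1)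
    (hu1 : ∀ x : ℝ, x ≤ 1 → u x = 1) (hu2 : ∀ x : ℝ, 2 ≤ x → u x = 0)
    (j k : ℕ) (hj0 : 0 < j) (hjm : j < jmax M T) (hk0 : 0 < k) (hkm : k < kmax M T j)
    (α β : ℝ) (hα : 1 ≤ α) (hchi : chiJK u M T j k α β ≠ 0) :
    (M ^ (2 * j + 2 * k - 2) ≤ α ∧ α ≤ 2 * M ^ (2 * j + 2 * k)) ∧
    ((4 * M ^ 3)⁻¹ * M ^ (2 * ((j : ℝ) - (k : ℝ) / 3)) ≤ 1 + β ^ 2 ∧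
      1 + β ^ 2 ≤ 4 * M ^ 3 * M ^ (2 * ((j : ℝ) - (k : ℝ) / 3))) := by
  have hM1 : 1 ≤ M := by linarith
  have hM0 : 0 < M := by linarith
  have hα0 : 0 ≤ α := by linarith
  have hkne : kmax M T j ≠ 0 := by omega
  obtain ⟨hmain, haux⟩ := mul_ne_zero_iff.1 hchi
  rw [chiMain, if_neg hj0.ne', if_neg hjm.ne] at hmain
  rw [chiAux, if_neg hkne, if_neg hk0.ne', if_neg hkm.ne] at haux
  obtain ⟨hX1, hX2⟩ := bounds_of_cutoff_sub_ne_zero hu1 hu2 (by positivity)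
    (pow_le_pow_right₀ hM1 (Nat.sub_le _ _)) hmain
  obtain ⟨hα1, hα2⟩ := bounds_of_cutoff_sub_ne_zero hu1 hu2 (by positivity)
    (pow_le_pow_right₀ hM1 (Nat.sub_le _ _)) haux
  refine ⟨⟨hα1, hα2⟩, ?_⟩
  have hX4 := Xab_pow_four hα0 β
  have hX0 := Xab_nonneg hα0 β
  generalize Xab α β = X at hX1 hX2 hX4 hX0
  have hY : (M ^ (2 * ((j : ℝ) - (k : ℝ) / 3))) ^ 3 * (M ^ k) ^ 2 = (M ^ j) ^ 6 := by
    rw [← Real.rpow_mul_natCast hM0.le, ← pow_mul, ← pow_mul, ← Real.rpow_natCast M (k * 2),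
      ← Real.rpow_natCast M (j * 6), ← Real.rpow_add hM0]
    congr 1
    push_cast
    ring
  have hY0 : 0 < M ^ (2 * ((j : ℝ) - (k : ℝ) / 3)) := by positivity
  generalize M ^ (2 * ((j : ℝ) - (k : ℝ) / 3)) = Y at hY hY0
  have hXa : (M ^ j) ^ 2 ≤ M ^ 2 * X := by
    calc (M ^ j) ^ 2 = M ^ 2 * M ^ (2 * j - 2) := by
          rw [← pow_add, ← pow_mul]
          congr 1
          omega
      _ ≤ M ^ 2 * X := by gcongr
  have hXb : X ≤ 2 * (M ^ j) ^ 2 := by rwa [← pow_mul, mul_comm j 2]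
  have hαa : (M ^ j) ^ 2 * (M ^ k) ^ 2 ≤ M ^ 2 * α := by
    calc (M ^ j) ^ 2 * (M ^ k) ^ 2 = M ^ 2 * M ^ (2 * j + 2 * k - 2) := by
          rw [← pow_add, ← pow_mul, ← pow_mul, ← pow_add]
          congr 1
          omega
      _ ≤ M ^ 2 * α := by gcongr
  have hαb : α ≤ 2 * ((M ^ j) ^ 2 * (M ^ k) ^ 2) := by
    rwa [← pow_mul, ← pow_mul, ← pow_add, mul_comm j 2, mul_comm k 2]
  have ha0 : 0 < M ^ j := by positivity
  have hb1 : 1 ≤ M ^ k := one_le_pow₀ hM1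
  clear hX1 hX2 hα1 hα2
  generalize M ^ j = a at *
  generalize M ^ k = b at *
  have hb0 : 0 < b := by linarith
  have hB0 : 0 < 1 + β ^ 2 := by positivity
  constructor
  · rw [inv_mul_le_iff₀ (by positivity), ← pow_le_pow_iff_left₀ hY0.le (by positivity) three_ne_zero]
    have hweak : 4 * M ^ 8 * (1 + β ^ 2) ^ 3 ≤ (4 * M ^ 3 * (1 + β ^ 2)) ^ 3 := by
      calc 4 * M ^ 8 * (1 + β ^ 2) ^ 3 ≤ 64 * M ^ 9 * (1 + β ^ 2) ^ 3 := by
            gcongr <;> norm_num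
        _ = (4 * M ^ 3 * (1 + β ^ 2)) ^ 3 := by ring
    refine le_trans ?_ hweak
    rcases le_total (β ^ 2) α with h | h
    · have key : a ^ 2 * (Y ^ 3 * b ^ 2) ≤ a ^ 2 * (4 * M ^ 8 * (1 + β ^ 2) ^ 3 * b ^ 2) := by
        calc a ^ 2 * (Y ^ 3 * b ^ 2) = (a ^ 2) ^ 4 := by rw [hY]; ring
          _ ≤ (M ^ 2 * X) ^ 4 := by gcongr
          _ = M ^ 8 * ((1 + β ^ 2) ^ 3 * (α + β ^ 2)) := by rw [mul_pow, hX4]; ring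
          _ ≤ M ^ 8 * ((1 + β ^ 2) ^ 3 * (4 * (a ^ 2 * b ^ 2))) := by
            gcongr
            linarith
          _ = a ^ 2 * (4 * M ^ 8 * (1 + β ^ 2) ^ 3 * b ^ 2) := by ring
      exact le_of_mul_le_mul_right (le_of_mul_le_mul_left key (by positivity)) (by positivity)
    · have haB : a ^ 2 ≤ M ^ 2 * (1 + β ^ 2) := by
        calc a ^ 2 ≤ a ^ 2 * b ^ 2 := le_mul_of_one_le_right (by positivity) (one_le_pow₀ hb1)
          _ ≤ M ^ 2 * α := hαa
          _ ≤ M ^ 2 * (1 + β ^ 2) := by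
            gcongr
            linarith
      calc Y ^ 3 ≤ Y ^ 3 * b ^ 2 := le_mul_of_one_le_right (by positivity) (one_le_pow₀ hb1)
        _ = (a ^ 2) ^ 3 := by rw [hY]; ring
        _ ≤ (M ^ 2 * (1 + β ^ 2)) ^ 3 := by gcongr
        _ = 1 * M ^ 6 * (1 + β ^ 2) ^ 3 := by ring
        _ ≤ 4 * M ^ 8 * (1 + β ^ 2) ^ 3 := by gcongr <;> norm_num
  · rw [← pow_le_pow_iff_left₀ hB0.le (by positivity) three_ne_zero]
    have key : a ^ 2 * b ^ 2 * (1 + β ^ 2) ^ 3 ≤ a ^ 2 * b ^ 2 * (16 * M ^ 2 * Y ^ 3) := by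
      calc a ^ 2 * b ^ 2 * (1 + β ^ 2) ^ 3 ≤ M ^ 2 * α * (1 + β ^ 2) ^ 3 := by gcongr
        _ ≤ M ^ 2 * (α + β ^ 2) * (1 + β ^ 2) ^ 3 := by
          gcongr
          linarith [sq_nonneg β]
        _ = M ^ 2 * X ^ 4 := by rw [hX4]; ring
        _ ≤ M ^ 2 * (2 * a ^ 2) ^ 4 := by gcongr
        _ = 16 * M ^ 2 * a ^ 2 * a ^ 6 := by ring
        _ = a ^ 2 * b ^ 2 * (16 * M ^ 2 * Y ^ 3) := by rw [← hY]; ring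
    calc (1 + β ^ 2) ^ 3 ≤ 16 * M ^ 2 * Y ^ 3 := le_of_mul_le_mul_left key (by positivity)
      _ ≤ 64 * M ^ 9 * Y ^ 3 := by gcongr <;> norm_num
      _ = (4 * M ^ 3 * Y) ^ 3 := by ring
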